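/- The Veech group Γ(U_L) of the origami L(2,3) is a subgroup of index 9 in SL₂(ℤ). -/

import Mathlib

/-- The free group on two generators. -/
abbrev F2 := FreeGroup (Fin 2)

/-- The generator `x` of `F₂`. -/
def xg : F2 := FreeGroup.of 0

/-- The generator `y` of `F₂`. -/
def yg : F2 := FreeGroup.of 1

/-- The exponent sum of the `i`-th generator, i.e. the `i`-th coordinate of the image in the
abelianization `ℤ²` of `F₂`. -/
def expSum (i : Fin 2) : F2 →* Multiplicative ℤ :=
  FreeGroup.lift fun j => Multiplicative.ofAdd (if j = i then (1 : ℤ) else 0)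

/-- The matrix in `GL₂(ℤ)` induced by an automorphism `γ` of `F₂` on the abelianization
`F₂^ab ≅ ℤ²` (with basis the images of `x` and `y`); i.e. `β̂(γ)`. -/
def autMat (γ : F2 ≃* F2) : Matrix (Fin 2) (Fin 2) ℤ :=
  Matrix.of fun i j => Multiplicative.toAdd (expSum i (γ (FreeGroup.of j)))

abbrev SL2Z := Matrix.SpecialLinearGroup (Fin 2) ℤ

/-- `Stab(V) = {γ ∈ Aut⁺(F₂) : γ(V) = V}`. -/
def StabSet (V : Subgroup F2) : Set (F2 ≃* F2) :=
  { γ | (autMat γ).det = 1 ∧ Subgroup.map γ.toMonoidHom V = V }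

/-- The Veech group `Γ(V) = β̂(Stab(V)) ⊆ SL₂(ℤ)` of a subgroup `V` of `F₂`. -/
def VeechGroup (V : Subgroup F2) : Set SL2Z :=
  { A | ∃ γ : F2 ≃* F2, γ ∈ StabSet V ∧ (A : Matrix (Fin 2) (Fin 2) ℤ) = autMat γ }

/-- A set of elements of `SL₂(ℤ)` is a congruence group if it contains the principal congruence
subgroup `Γ(n)` for some `n ≥ 1`. -/
def IsCongruenceSet (S : Set SL2Z) : Prop :=
  ∃ n : ℕ, 1 ≤ n ∧ (CongruenceSubgroup.Gamma n : Set SL2Z) ⊆ S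

/-- The subgroup of `Multiplicative ℤ` of elements divisible by `n`. -/
def divSub (n : ℤ) : Subgroup (Multiplicative ℤ) where
  carrier := {d | n ∣ Multiplicative.toAdd d}
  one_mem' := dvd_zero n
  mul_mem' := fun ha hb => dvd_add ha hb
  inv_mem' := fun ha => dvd_neg.mpr ha

/-- The subgroup `Hₙ = {u ∈ U : n ∣ α(u)}` of `F₂` (for `n = 0` this is `ker α = H₀`). -/
def Hgrp {U : Subgroup F2} (α : U →* Multiplicative ℤ) (n : ℕ) : Subgroup F2 :=
  Subgroup.map U.subtype (Subgroup.comap α (divSub (n : ℤ)))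

/-- The subgroup `U_L` of `F₂` corresponding to the origami `L(2,3)`. -/
def UL : Subgroup F2 :=
  Subgroup.closure {xg ^ 3, xg * yg * xg⁻¹, xg ^ 2 * yg * (xg ^ 2)⁻¹, yg * xg * yg⁻¹, yg ^ 2}

/-- The subgroup `U_D` of `F₂` corresponding to the origami `D`. -/
def UD : Subgroup F2 :=
  Subgroup.closure {xg ^ 3, xg * yg * (xg ^ 2)⁻¹, xg ^ 2 * yg * xg⁻¹, yg * xg * yg⁻¹,
    yg ^ 2 * xg * (yg ^ 2)⁻¹, yg ^ 3}

section WordLength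

open FreeGroup

variable {α : Type*} [DecidableEq α]

/-- The length of the longest common initial segment of two lists. -/
def commonPrefixLength {β : Type*} [DecidableEq β] : List β → List β → ℕ
  | a :: l, b :: m => if a = b then commonPrefixLength l m + 1 else 0
  | _, _ => 0

theorem commonPrefixLength_min_le {β : Type*} [DecidableEq β] (l m n : List β) :
    min (commonPrefixLength l m) (commonPrefixLength m n) ≤ commonPrefixLength l n := by
  induction l generalizing m n with
  | nil => cases m <;> simp [commonPrefixLength]
  | cons a l ih =>
    cases m with
    | nil => simp [commonPrefixLength]
    | cons b m =>
      cases n with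
      | nil => simp [commonPrefixLength]
      | cons c n =>
        have := ih m n
        simp only [commonPrefixLength]
        split_ifs <;> first | omega | simp_all

theorem FreeGroup.norm_mk_of_isReduced {L : List (α × Bool)} (h : IsReduced L) :
    norm (mk L) = L.length := by
  rw [norm, toWord_mk, h.reduce_eq]

theorem FreeGroup.norm_inv_mk_mul_mk {l m : List (α × Bool)} (hl : IsReduced l)
    (hm : IsReduced m) :
    norm ((mk l)⁻¹ * mk m) + 2 * commonPrefixLength l m = l.length + m.length := by
  induction l generalizing m with
  | nil =>
    have h1 : (mk ([] : List (α × Bool))) = 1 := rfl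
    simp [commonPrefixLength, norm_mk_of_isReduced hm, h1]
  | cons a l ih =>
    cases m with
    | nil =>
      have h1 : (mk ([] : List (α × Bool))) = 1 := rfl
      rw [h1, mul_one, norm_inv_eq, norm_mk_of_isReduced hl]
      simp [commonPrefixLength]
    | cons b m =>
      by_cases hab : a = b
      · subst hab
        have e : ∀ k : List (α × Bool), mk (a :: k) = mk [a] * mk k := fun k => by simp
        have := ih (m := m) (List.IsChain.tail hl) (List.IsChain.tail hm)
        rw [e l, e m, mul_inv_rev, mul_assoc, inv_mul_cancel_left]
        simp only [commonPrefixLength, if_true, List.length_cons]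
        omega
      · simp only [commonPrefixLength, if_neg hab]
        rw [inv_mk, mul_mk, norm_mk_of_isReduced]
        · simp
        · have h1 : IsReduced (invRev (a :: l)) := by
            rw [isReduced_iff_reduce_eq, reduce_invRev, hl.reduce_eq]
          rw [IsReduced, List.isChain_append]
          refine ⟨h1, hm, ?_⟩
          intro x hx y hy
          simp [invRev] at hx hy
          subst hx hy
          rintro h
          by_contra hne
          apply hab
          ext
          · exact h
          · revert hne; cases a.2 <;> cases b.2 <;> simp

/-- The Gromov product of two elements of a free group: the length of the longest
common initial segment of their reduced words. -/
def FreeGroup.gromov (g h : FreeGroup α) : ℕ := commonPrefixLength g.toWord h.toWord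

theorem FreeGroup.norm_inv_mul (g h : FreeGroup α) :
    norm (g⁻¹ * h) + 2 * gromov g h = norm g + norm h := by
  have := norm_inv_mk_mul_mk (isReduced_toWord (x := g)) (isReduced_toWord (x := h))
  rwa [mk_toWord, mk_toWord] at this

theorem FreeGroup.min_gromov_le (g h k : FreeGroup α) :
    min (gromov g h) (gromov h k) ≤ gromov g k :=
  commonPrefixLength_min_le _ _ _

theorem FreeGroup.exists_norm_eq_and_gromov_eq (g : FreeGroup α) {k : ℕ} (hk : k ≤ norm g) :
    ∃ p : FreeGroup α, norm p = k ∧ gromov p g = k := by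
  have hg := isReduced_toWord (x := g)
  have ht : IsReduced (g.toWord.take k) :=
    List.IsChain.take hg k
  have hd : IsReduced (g.toWord.drop k) :=
    List.IsChain.drop hg k
  have e : mk (g.toWord.take k) * mk (g.toWord.drop k) = g := by
    rw [mul_mk, List.take_append_drop, mk_toWord]
  have h1 : norm (mk (g.toWord.take k)) = k := by
    rw [norm_mk_of_isReduced ht, List.length_take]; exact min_eq_left hk
  refine ⟨mk (g.toWord.take k), h1, ?_⟩
  have h2 := norm_inv_mul (mk (g.toWord.take k)) g
  have h3 : (mk (g.toWord.take k))⁻¹ * g = mk (g.toWord.drop k) := by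
    rw [inv_mul_eq_iff_eq_mul, e]
  rw [h3, norm_mk_of_isReduced hd, List.length_drop, h1] at h2
  have : norm g = g.toWord.length := rfl
  omega

theorem FreeGroup.norm_lt_norm_mul_self {g : FreeGroup α} (hg : g ≠ 1) :
    norm g < norm (g * g) := by
  have h := reduceCyclically.reduce_flatten_replicate_succ (isReduced_toWord (x := g)) 1
  have h' := reduceCyclically.conj_conjugator_reduceCyclically g.toWord
  rw [← pow_two, norm, norm, toWord_pow, h]
  have hl := congrArg List.length h'
  have hc : (reduceCyclically g.toWord).length ≠ 0 := by
    intro h0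
    rw [List.length_eq_zero_iff] at h0
    rw [h0] at h'
    apply hg
    rw [← mk_toWord (x := g), ← h', List.append_nil, ← mul_mk, ← inv_mk, mul_inv_cancel]
  simp at hl ⊢
  omega

theorem FreeGroup.gromov_comm (g h : FreeGroup α) : gromov g h = gromov h g := by
  have h1 := norm_inv_mul g h
  have h2 := norm_inv_mul h g
  have h3 : norm (g⁻¹ * h) = norm (h⁻¹ * g) := by
    rw [← norm_inv_eq (x := g⁻¹ * h), mul_inv_rev, inv_inv]
  omega

theorem FreeGroup.norm_mul (g h : FreeGroup α) :
    norm (g * h) + 2 * gromov g⁻¹ h = norm g + norm h := by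
  have := norm_inv_mul g⁻¹ h
  rwa [inv_inv, norm_inv_eq] at this

/-- In a Nielsen reduced family, a nonempty reduced product of `n` factors has length at
least `n`. -/
theorem FreeGroup.length_le_norm_prod_of_nielsenReduced {β : Type*} {R : β → β → Prop}
    {s : β → FreeGroup α} (h0 : ∀ p, s p ≠ 1)
    (h1 : ∀ p q, R p q → 2 * gromov (s p)⁻¹ (s q) ≤ norm (s q))
    (h0' : ∀ p q, R p q → 2 * gromov (s p)⁻¹ (s q) ≤ norm (s p))
    (h2 : ∀ p q r, R p q → R q r →
      gromov (s p)⁻¹ (s q) + gromov (s q)⁻¹ (s r) < norm (s q))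
    (L : List β) (p : β) (hL : (p :: L).IsChain R) :
    L.length + 1 ≤ norm ((p :: L).map s).prod ∧ ∀ r, R r p →
      gromov (s r)⁻¹ ((p :: L).map s).prod = gromov (s r)⁻¹ (s p) ∧
      L.length + 1 + gromov (s r)⁻¹ (s p) ≤ norm ((p :: L).map s).prod := by
  induction L generalizing p with
  | nil =>
    have hp : norm (s p) ≠ 0 := fun h => h0 p (norm_eq_zero.mp h)
    rw [List.map_cons, List.map_nil, List.prod_cons, List.prod_nil, mul_one,
      List.length_nil]
    refine ⟨by omega, fun r hr => ⟨rfl, ?_⟩⟩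
    have := h1 r p hr
    omega
  | cons q L ih =>
    rw [List.isChain_cons_cons] at hL
    obtain ⟨hpq, hL⟩ := hL
    obtain ⟨ih1, ih2⟩ := ih q hL
    obtain ⟨ih3, ih4⟩ := ih2 p hpq
    rw [List.map_cons, List.prod_cons, List.length_cons]
    set w := ((q :: L).map s).prod with hw
    have e1 := norm_mul (s p) w
    have e2 := norm_inv_mul (s p) (s p * w)
    rw [inv_mul_cancel_left] at e2
    have e3 := h0' p q hpq
    have hp : norm (s p) ≠ 0 := fun h => h0 p (norm_eq_zero.mp h)
    refine ⟨by omega, fun r hr => ?_⟩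
    have e4 := h2 r p q hr hpq
    have e5 := min_gromov_le (s r)⁻¹ (s p) (s p * w)
    have e6 := min_gromov_le (s r)⁻¹ (s p * w) (s p)
    rw [gromov_comm (s p * w) (s p)] at e6
    exact ⟨by omega, by omega⟩

/-- A minimal pair has small cancellation between its members. -/
theorem FreeGroup.two_mul_gromov_le_of_minimal {u v : FreeGroup α}
    (hu : norm u ≤ norm (u * v)) (hv : norm v ≤ norm (u * v)) :
    2 * gromov u⁻¹ v ≤ norm u ∧ 2 * gromov u⁻¹ v ≤ norm v := by
  have := norm_mul u v
  omega

theorem FreeGroup.two_mul_gromov_inv_self_lt {u : FreeGroup α} (hu : u ≠ 1) :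
    2 * gromov u⁻¹ u < norm u := by
  have := norm_mul u u
  have := norm_lt_norm_mul_self hu
  omega

theorem FreeGroup.gromov_add_gromov_lt_of_inv {u v : FreeGroup α} (hu : u ≠ 1)
    (h1 : 2 * gromov v⁻¹ u ≤ norm u) (h2 : 2 * gromov u⁻¹ v⁻¹ ≤ norm u) :
    gromov v⁻¹ u + gromov u⁻¹ v⁻¹ < norm u := by
  have h3 := two_mul_gromov_inv_self_lt hu
  have h4 := min_gromov_le u⁻¹ v⁻¹ u
  omega

theorem FreeGroup.gromov_add_gromov_lt_of_minimal {u v : FreeGroup α} (hu : u ≠ 1)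
    (h1 : 2 * gromov v⁻¹ u ≤ norm u) (h2 : 2 * gromov u⁻¹ v ≤ norm u)
    (h3 : 2 * gromov v⁻¹ u ≤ norm v)
    (hmin : ∀ p, norm u + norm v ≤ norm (p⁻¹ * u * p) + norm (p⁻¹ * (u * v) * p)) :
    gromov v⁻¹ u + gromov u⁻¹ v < norm u := by
  by_contra! hcon
  have hu0 : norm u ≠ 0 := fun h => hu (norm_eq_zero.mp h)
  obtain ⟨p, hp, hpu⟩ := exists_norm_eq_and_gromov_eq u (k := gromov u⁻¹ v) (by omega)
  have e1 := norm_inv_mul p u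
  have e2 := norm_inv_mul (p⁻¹ * u)⁻¹ p
  have e3 := norm_mul (p⁻¹ * u) v
  have hq := norm_inv_eq (x := p⁻¹ * u)
  rw [inv_inv] at e2
  have hm := hmin p
  rw [← mul_assoc p⁻¹ u v] at hm
  have e4 := norm_mul v p
  have e5 := min_gromov_le v⁻¹ u p
  rw [gromov_comm u p] at e5
  have e6 := min_gromov_le (p⁻¹ * u)⁻¹ u⁻¹ v
  have e7 := norm_inv_mul (p⁻¹ * u)⁻¹ u⁻¹
  have e8 : norm (((p⁻¹ * u)⁻¹)⁻¹ * u⁻¹) = norm p := by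
    rw [← norm_inv_eq (x := p)]; congr 1; group
  have hi := norm_inv_eq (x := u)
  have e9 := min_gromov_le (p⁻¹ * u)⁻¹ v (v * p)
  have e10 := norm_inv_mul v (v * p)
  rw [inv_mul_cancel_left] at e10
  have e11 := norm_mul (p⁻¹ * u) (v * p)
  rw [← mul_assoc (p⁻¹ * u) v p] at e11
  omega

end WordLength

/-- A relation on pairs of elements of a group which is stable under the elementary Nielsen
moves and under simultaneous conjugation. -/
structure NielsenStable {G : Type*} [Group G] (B : G → G → Prop) : Prop where
  swap : ∀ {a b}, B a b → B b a
  inv : ∀ {a b}, B a b → B a⁻¹ b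
  mul : ∀ {a b}, B a b → B a (a * b)
  conj : ∀ {a b} (g : G), B a b → B (g * a * g⁻¹) (g * b * g⁻¹)

namespace NielsenStable

variable {G : Type*} [Group G] {B C : G → G → Prop}

theorem inv_right (hB : NielsenStable B) {a b : G} (h : B a b) : B a b⁻¹ :=
  hB.swap (hB.inv (hB.swap h))

theorem inv_mul (hB : NielsenStable B) {a b : G} (h : B a b) : B a (a⁻¹ * b) := by
  simpa using hB.inv (hB.mul (hB.inv h))

theorem and_not (hB : NielsenStable B) (hC : NielsenStable C) :
    NielsenStable fun a b => C a b ∧ ¬ B a b where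
  swap h := ⟨hC.swap h.1, fun h' => h.2 (hB.swap h')⟩
  inv h := ⟨hC.inv h.1, fun h' => h.2 (by simpa using hB.inv h')⟩
  mul h := ⟨hC.mul h.1, fun h' => h.2 (by simpa using hB.inv_mul h')⟩
  conj g h := ⟨hC.conj g h.1, fun h' => h.2 (by simpa [mul_assoc] using hB.conj g⁻¹ h')⟩

end NielsenStable

theorem nielsenStable_closure_eq_top {G : Type*} [Group G] :
    NielsenStable fun a b : G => Subgroup.closure {a, b} = ⊤ where
  swap h := by rwa [Set.pair_comm]
  inv {a b} h := by
    rw [eq_top_iff, ← h, Subgroup.closure_le, Set.pair_subset_iff]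
    refine ⟨?_, Subgroup.subset_closure (by simp)⟩
    have : a⁻¹ ∈ Subgroup.closure {a⁻¹, b} := Subgroup.subset_closure (by simp)
    exact inv_mem_iff.mp this
  mul {a b} h := by
    rw [eq_top_iff, ← h, Subgroup.closure_le, Set.pair_subset_iff]
    have h1 : a ∈ Subgroup.closure {a, a * b} := Subgroup.subset_closure (by simp)
    have h2 : a * b ∈ Subgroup.closure {a, a * b} := Subgroup.subset_closure (by simp)
    exact ⟨h1, (Subgroup.mul_mem_cancel_left _ h1).mp h2⟩
  conj {a b} g h := by
    have h1 := congrArg (Subgroup.map (MulAut.conj g).toMonoidHom) h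
    rw [MonoidHom.map_closure, Set.image_pair, Subgroup.map_top_of_surjective _
      (MulAut.conj g).surjective] at h1
    exact h1

open FreeGroup in
theorem ne_one_of_closure_eq_top {a b : F2} (h : Subgroup.closure {a, b} = ⊤) : a ≠ 1 := by
  rintro rfl
  have hmem : ∀ z : F2, z ∈ Subgroup.zpowers b := by
    intro z
    rw [Subgroup.zpowers_eq_closure]
    have : z ∈ Subgroup.closure {1, b} := h ▸ Subgroup.mem_top z
    rwa [Subgroup.closure_insert_one] at this
  obtain ⟨m, hm⟩ := hmem xg
  obtain ⟨n, hn⟩ := hmem yg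
  have hc : xg * yg = yg * xg := by
    rw [← hm, ← hn, ← zpow_add, ← zpow_add, add_comm]
  revert hc
  decide

/-- The letter `(i, e)` evaluated at a pair of elements `w`. -/
def signedLetter {G : Type*} [Group G] (w : Fin 2 → G) (p : Fin 2 × Bool) : G :=
  cond p.2 (w p.1) (w p.1)⁻¹

/-- In a free group of rank two, a generating pair which is of minimal total length among all
its Nielsen transforms and their conjugates consists of letters: both `x` and `y` are, up to
inversion, members of the pair. -/
theorem exists_signedLetter_eq_of_minimal {Q : F2 → F2 → Prop} (hQ : NielsenStable Q)
    (hgen : ∀ {a b}, Q a b → Subgroup.closure {a, b} = ⊤) {w : Fin 2 → F2} (hw : Q (w 0) (w 1))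
    (hmin : ∀ {a b}, Q a b →
      FreeGroup.norm (w 0) + FreeGroup.norm (w 1) ≤ FreeGroup.norm a + FreeGroup.norm b)
    {z : F2} (hz : FreeGroup.norm z = 1) : ∃ p, signedLetter w p = z := by
  classical
  have hne : ∀ p, signedLetter w p ≠ 1 := by
    rintro ⟨i, e⟩
    have h0 := ne_one_of_closure_eq_top (hgen hw)
    have h1 := ne_one_of_closure_eq_top (hgen (hQ.swap hw))
    fin_cases i <;> cases e <;> simpa [signedLetter]
  have hinv : ∀ i e, signedLetter w (i, !e) = (signedLetter w (i, e))⁻¹ := by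
    intro i e; cases e <;> simp [signedLetter]
  have hQs : ∀ p q : Fin 2 × Bool, p.1 ≠ q.1 → Q (signedLetter w p) (signedLetter w q) := by
    rintro ⟨i, e⟩ ⟨j, f⟩ hij
    have h1 := hQ.swap hw
    have h2 : Q (w i) (w j) := by
      fin_cases i <;> fin_cases j <;> first | exact absurd rfl hij | assumption
    cases e <;> cases f <;> simp only [signedLetter, cond] <;>
      first | exact h2 | exact hQ.inv h2 | exact hQ.inv_right h2 | exact hQ.inv (hQ.inv_right h2)
  have hsum : ∀ p q : Fin 2 × Bool, p.1 ≠ q.1 → ∀ {a b}, Q a b →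
      FreeGroup.norm (signedLetter w p) + FreeGroup.norm (signedLetter w q) ≤
        FreeGroup.norm a + FreeGroup.norm b := by
    rintro ⟨i, e⟩ ⟨j, f⟩ hij a b hab
    have h1 := hmin hab
    have h2 : ∀ i e, FreeGroup.norm (signedLetter w (i, e)) = FreeGroup.norm (w i) := by
      intro i e; cases e <;> simp [signedLetter]
    rw [h2, h2]
    fin_cases i <;> fin_cases j <;> first | exact absurd rfl hij | (simp; omega)
  have hcan : ∀ p q : Fin 2 × Bool, (p.1 = q.1 → p.2 = q.2) →
      2 * FreeGroup.gromov (signedLetter w p)⁻¹ (signedLetter w q) ≤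
        FreeGroup.norm (signedLetter w p) ∧
      2 * FreeGroup.gromov (signedLetter w p)⁻¹ (signedLetter w q) ≤
        FreeGroup.norm (signedLetter w q) := by
    intro p q hpq
    by_cases h : p.1 = q.1
    · obtain rfl : p = q := Prod.ext h (hpq h)
      have := FreeGroup.two_mul_gromov_inv_self_lt (hne p)
      omega
    · have h1 := hQs p q h
      have h2 := hsum p q h (hQ.mul h1)
      have h3 := hsum p q h (hQ.inv (hQ.mul (hQ.swap (hQ.inv (hQ.inv_right h1)))))
      have h4 : FreeGroup.norm ((signedLetter w q)⁻¹ * (signedLetter w p)⁻¹) =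
          FreeGroup.norm (signedLetter w p * signedLetter w q) := by
        rw [← FreeGroup.norm_inv_eq (x := signedLetter w p * signedLetter w q), mul_inv_rev]
      rw [h4, inv_inv] at h3
      exact FreeGroup.two_mul_gromov_le_of_minimal (by omega) (by omega)
  have hred : ∀ p q r : Fin 2 × Bool, (p.1 = q.1 → p.2 = q.2) → (q.1 = r.1 → q.2 = r.2) →
      FreeGroup.gromov (signedLetter w p)⁻¹ (signedLetter w q) +
        FreeGroup.gromov (signedLetter w q)⁻¹ (signedLetter w r) <
        FreeGroup.norm (signedLetter w q) := by
    intro p q r hpq hqr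
    have h1 := hcan p q hpq
    have h2 := hcan q r hqr
    have h3 := FreeGroup.two_mul_gromov_inv_self_lt (hne q)
    by_cases hp : p.1 = q.1
    · obtain rfl : p = q := Prod.ext hp (hpq hp)
      omega
    by_cases hr : q.1 = r.1
    · obtain rfl : q = r := Prod.ext hr (hqr hr)
      omega
    have hpr : p.1 = r.1 := by omega
    by_cases he : p.2 = r.2
    · obtain rfl : p = r := Prod.ext hpr he
      refine FreeGroup.gromov_add_gromov_lt_of_minimal (hne q) h1.2 h2.1 h1.1 fun g => ?_
      simpa using hsum q p hr (hQ.conj g⁻¹ (hQ.mul (hQs q p hr)))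
    · have hrp : signedLetter w r = (signedLetter w p)⁻¹ := by
        obtain ⟨i, e⟩ := p
        obtain ⟨j, f⟩ := r
        obtain rfl : i = j := hpr
        rw [← hinv]
        have hf : f = !e := by cases e <;> cases f <;> simp at he ⊢
        rw [hf]
      rw [hrp] at h2 ⊢
      exact FreeGroup.gromov_add_gromov_lt_of_inv (hne q) h1.2 h2.1
  obtain ⟨u, rfl⟩ : ∃ u : F2, FreeGroup.lift w u = z := by
    have h1 : (FreeGroup.lift w).range = ⊤ := by
      rw [FreeGroup.range_lift_eq_closure, ← hgen hw]
      congr 1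
      ext t
      rw [Set.mem_range, Fin.exists_fin_two, Set.mem_insert_iff, Set.mem_singleton_iff,
        eq_comm (a := t), eq_comm (a := t)]
    have h2 : z ∈ (FreeGroup.lift w).range := h1 ▸ Subgroup.mem_top z
    exact h2
  have hu : FreeGroup.lift w u = (u.toWord.map (signedLetter w)).prod := by
    conv_lhs => rw [← FreeGroup.mk_toWord (x := u), FreeGroup.lift_mk]
    rfl
  have hredu := FreeGroup.isReduced_toWord (x := u)
  rw [hu] at hz ⊢
  cases hL : u.toWord with
  | nil => simp [hL] at hz
  | cons p L =>
    rw [hL] at hz hredu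
    have h := (FreeGroup.length_le_norm_prod_of_nielsenReduced hne
      (fun p q h => (hcan p q h).2) (fun p q h => (hcan p q h).1) hred L p hredu).1
    have hL0 : L = [] := List.length_eq_zero_iff.mp (by omega)
    exact ⟨p, by simp [hL0]⟩

/-- Nielsen's theorem for generating pairs of the free group of rank two: every generating pair
can be reached from the standard basis. -/
theorem NielsenStable.of_closure_eq_top {B : F2 → F2 → Prop} (hB : NielsenStable B)
    (hxy : B xg yg) {a b : F2} (hab : Subgroup.closure {a, b} = ⊤) : B a b := by
  classical
  by_contra hnot
  have hQ := hB.and_not nielsenStable_closure_eq_top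
  have hex : ∃ n a b, (Subgroup.closure {a, b} = ⊤ ∧ ¬ B a b) ∧
      FreeGroup.norm a + FreeGroup.norm b = n := ⟨_, a, b, ⟨hab, hnot⟩, rfl⟩
  obtain ⟨c, d, hcd, hn⟩ := Nat.find_spec hex
  have key : ∀ {z : F2}, FreeGroup.norm z = 1 → ∃ p, signedLetter ![c, d] p = z := by
    intro z hz
    refine exists_signedLetter_eq_of_minimal (w := ![c, d]) hQ (fun h => h.1) hcd ?_ hz
    intro a' b' h'
    exact hn.trans_le (Nat.find_min' hex ⟨a', b', h', rfl⟩)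
  have key' : ∀ {z : F2}, FreeGroup.norm z = 1 → c = z ∨ c = z⁻¹ ∨ d = z ∨ d = z⁻¹ := by
    intro z hz
    obtain ⟨⟨i, e⟩, hp⟩ := key hz
    simp only [← hp]
    fin_cases i <;> cases e <;> simp [signedLetter]
  have hx : FreeGroup.norm xg = 1 := FreeGroup.norm_of _
  have hy : FreeGroup.norm yg = 1 := FreeGroup.norm_of _
  have h1 : xg ≠ yg ∧ xg ≠ yg⁻¹ ∧ xg⁻¹ ≠ yg ∧ xg⁻¹ ≠ yg⁻¹ := by decide
  obtain ⟨h1, h2, h3, h4⟩ := h1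
  apply hcd.2
  rcases key' hx with h | h | h | h <;> rcases key' hy with h' | h' | h' | h' <;>
    first | (rw [h] at h'; contradiction) | rw [h, h']
  · exact hxy
  · exact hB.inv_right hxy
  · exact hB.inv hxy
  · exact hB.inv_right (hB.inv hxy)
  · exact hB.swap hxy
  · exact hB.swap (hB.inv_right hxy)
  · exact hB.swap (hB.inv hxy)
  · exact hB.swap (hB.inv_right (hB.inv hxy))

/-- The pairs obtained from `(x, y)` and `(x, y⁻¹)` by positive substitutions. -/
inductive PositivePair : F2 → F2 → Prop
  | base : PositivePair xg yg
  | base_inv : PositivePair xg yg⁻¹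
  | mul_right {u v : F2} : PositivePair u v → PositivePair u (u * v)
  | mul_left {u v : F2} : PositivePair u v → PositivePair (u * v) v

/-- The pairs which are positive up to order, inversion and simultaneous conjugation. -/
inductive PositivePairUpTo : F2 → F2 → Prop
  | of {u v : F2} : PositivePair u v → PositivePairUpTo u v
  | swap {u v : F2} : PositivePairUpTo u v → PositivePairUpTo v u
  | inv {u v : F2} : PositivePairUpTo u v → PositivePairUpTo u⁻¹ v
  | conj {u v : F2} (g : F2) : PositivePairUpTo u v →
      PositivePairUpTo (g * u * g⁻¹) (g * v * g⁻¹)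

namespace PositivePairUpTo

theorem inv_right {u v : F2} (h : PositivePairUpTo u v) : PositivePairUpTo u v⁻¹ :=
  h.swap.inv.swap

theorem mul_comm_right {u v : F2} (h : PositivePairUpTo u (u * v)) :
    PositivePairUpTo u (v * u) := by
  simpa [mul_assoc] using h.conj u⁻¹

theorem mul_comm_left {u v : F2} (h : PositivePairUpTo u (v * u)) :
    PositivePairUpTo u (u * v) := by
  simpa [mul_assoc] using h.conj u

theorem inv_mul_of_positivePair {u v : F2} (h : PositivePair u v) :
    PositivePairUpTo u (u⁻¹ * v) ∧ PositivePairUpTo v (v⁻¹ * u) := by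
  cases h with
  | base =>
    have h1 := (of PositivePair.base_inv.mul_right).mul_comm_right.inv_right
    have h2 := (of PositivePair.base_inv.mul_left).swap.inv.conj yg⁻¹
    exact ⟨by simpa using h1, by simpa [mul_assoc] using h2⟩
  | base_inv =>
    have h1 := (of PositivePair.base.mul_right).mul_comm_right.inv_right
    have h2 := (of PositivePair.base.mul_left).swap.mul_comm_left.inv
    exact ⟨by simpa using h1, by simpa using h2⟩
  | @mul_right u v h =>
    have h1 := (of h.mul_left).inv_right
    exact ⟨by simpa using of h, by simpa using h1⟩
  | @mul_left u v h =>
    have h1 := ((of h.mul_right).mul_comm_right.conj v⁻¹).swap.inv_right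
    have h2 := (of h).swap.conj v⁻¹
    exact ⟨by simpa [mul_assoc] using h1, by simpa [mul_assoc] using h2⟩

theorem mul_aux {u v : F2} (h : PositivePairUpTo u v) :
    (PositivePairUpTo u (u * v) ∧ PositivePairUpTo u (u⁻¹ * v)) ∧
      PositivePairUpTo v (v * u) ∧ PositivePairUpTo v (v⁻¹ * u) := by
  induction h with
  | of h =>
    have h1 := inv_mul_of_positivePair h
    exact ⟨⟨of h.mul_right, h1.1⟩, (of h.mul_left).swap.mul_comm_left, h1.2⟩
  | swap _ ih => exact ih.symm
  | inv _ ih =>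
    obtain ⟨⟨h1, h2⟩, h3, h4⟩ := ih
    refine ⟨⟨h2.inv, by simpa using h1.inv⟩, ?_, ?_⟩
    · have := h4.inv_right
      rw [mul_inv_rev, inv_inv] at this
      exact this.mul_comm_left
    · have := h3.mul_comm_right.inv_right.inv
      rw [mul_inv_rev] at this
      simpa using this.inv
  | conj g _ ih =>
    obtain ⟨⟨h1, h2⟩, h3, h4⟩ := ih
    exact ⟨⟨by simpa [mul_assoc] using h1.conj g, by simpa [mul_assoc] using h2.conj g⟩,
      by simpa [mul_assoc] using h3.conj g, by simpa [mul_assoc] using h4.conj g⟩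

end PositivePairUpTo

theorem nielsenStable_positivePairUpTo : NielsenStable PositivePairUpTo where
  swap h := h.swap
  inv h := h.inv
  mul h := h.mul_aux.1.1
  conj g h := h.conj g

/-- The exponent sum of the `i`-th generator, as an integer. -/
def expSumInt (i : Fin 2) (u : F2) : ℤ := Multiplicative.toAdd (expSum i u)

@[simp] theorem expSumInt_mul (i : Fin 2) (u v : F2) :
    expSumInt i (u * v) = expSumInt i u + expSumInt i v := by simp [expSumInt]

@[simp] theorem expSumInt_inv (i : Fin 2) (u : F2) :
    expSumInt i u⁻¹ = -expSumInt i u := by simp [expSumInt]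

@[simp] theorem expSumInt_xg (i : Fin 2) : expSumInt i xg = if i = 0 then 1 else 0 := by
  simp [expSumInt, expSum, xg, eq_comm]

@[simp] theorem expSumInt_yg (i : Fin 2) : expSumInt i yg = if i = 1 then 1 else 0 := by
  simp [expSumInt, expSum, yg, eq_comm]

/-- The sum of the absolute values of all exponent sums of a pair. -/
def expSumAbs (u v : F2) : ℤ :=
  |expSumInt 0 u| + |expSumInt 1 u| + |expSumInt 0 v| + |expSumInt 1 v|

theorem PositivePair.expSumInt_nonneg {u v : F2} (h : PositivePair u v) :
    ∃ ε : ℤ, (ε = 1 ∨ ε = -1) ∧ 1 ≤ expSumInt 0 u ∧ 0 ≤ ε * expSumInt 1 u ∧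
      0 ≤ expSumInt 0 v ∧ 1 ≤ ε * expSumInt 1 v := by
  induction h with
  | base => exact ⟨1, by simp⟩
  | base_inv => exact ⟨-1, by simp⟩
  | mul_right _ ih | mul_left _ ih =>
    obtain ⟨ε, h, h1, h2, h3, h4⟩ := ih
    refine ⟨ε, h, ?_⟩
    simp only [expSumInt_mul, mul_add]
    omega

/-- The pairs consisting of one letter `x^{±1}` and one letter `y^{±1}`, in either order. -/
def IsLetterPair (u v : F2) : Prop :=
  ((u = xg ∨ u = xg⁻¹) ∧ (v = yg ∨ v = yg⁻¹)) ∨ ((u = yg ∨ u = yg⁻¹) ∧ (v = xg ∨ v = xg⁻¹))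

theorem PositivePair.isLetterPair {u v : F2} (h : PositivePair u v)
    (h2 : expSumAbs u v = 2) : IsLetterPair u v := by
  cases h with
  | base => exact Or.inl (by simp)
  | base_inv => exact Or.inl (by simp)
  | mul_right h | mul_left h =>
    exfalso
    obtain ⟨ε, rfl | rfl, h1, h2, h3, h4⟩ := h.expSumInt_nonneg <;>
      simp only [expSumAbs, expSumInt_mul, abs_eq_max_neg] at * <;> omega

theorem PositivePairUpTo.exists_conj_isLetterPair {u v : F2} (h : PositivePairUpTo u v)
    (h2 : expSumAbs u v = 2) : ∃ g, IsLetterPair (g * u * g⁻¹) (g * v * g⁻¹) := by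
  induction h with
  | of h => exact ⟨1, by simpa using h.isLetterPair h2⟩
  | swap _ ih =>
    obtain ⟨g, hg⟩ := ih (by rw [← h2, expSumAbs, expSumAbs]; ring)
    exact ⟨g, hg.symm.imp And.symm And.symm⟩
  | inv _ ih =>
    obtain ⟨g, hg⟩ := ih (by rw [← h2, expSumAbs, expSumAbs]; simp)
    refine ⟨g, ?_⟩
    rw [← conj_inv]
    revert hg
    simp only [IsLetterPair, inv_eq_iff_eq_inv, inv_inv]
    tauto
  | conj k _ ih =>
    obtain ⟨g, hg⟩ := ih (by rw [← h2, expSumAbs, expSumAbs]; simp)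
    exact ⟨g * k⁻¹, by simpa [mul_assoc] using hg⟩

/-- Nielsen's theorem on pairs: a generating pair of `F₂` with the same image in `ℤ²` as the
standard basis is conjugate to the standard basis. -/
theorem exists_conj_eq_of_closure_eq_top {u v : F2} (h : Subgroup.closure {u, v} = ⊤)
    (hu0 : expSumInt 0 u = 1) (hu1 : expSumInt 1 u = 0)
    (hv0 : expSumInt 0 v = 0) (hv1 : expSumInt 1 v = 1) :
    ∃ g, g * u * g⁻¹ = xg ∧ g * v * g⁻¹ = yg := by
  have hP := nielsenStable_positivePairUpTo.of_closure_eq_top (.of .base) h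
  obtain ⟨g, hg⟩ := hP.exists_conj_isLetterPair (by simp [expSumAbs, hu0, hu1, hv0, hv1])
  refine ⟨g, ?_⟩
  have e : ∀ i w, expSumInt i (g * w * g⁻¹) = expSumInt i w := by intro i w; simp
  have e1 := e 0 u
  have e2 := e 1 v
  rcases hg with ⟨h1 | h1, h2 | h2⟩ | ⟨h1 | h1, h2 | h2⟩ <;> rw [h1] at e1 ⊢ <;>
    rw [h2] at e2 ⊢ <;> simp [hu0, hv1] at e1 e2 ⊢

theorem expSumInt_eq_sum (γ : F2 ≃* F2) (i : Fin 2) (w : F2) :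
    expSumInt i (γ w) = ∑ j, autMat γ i j * expSumInt j w := by
  induction w using FreeGroup.induction_on with
  | C1 => simp [expSumInt]
  | of k => fin_cases i <;> fin_cases k <;> simp [autMat, expSumInt, expSum]
  | inv_of k ih => simp only [map_inv, expSumInt_inv, ih, mul_neg, Finset.sum_neg_distrib]
  | mul u v hu hv => simp only [map_mul, expSumInt_mul, hu, hv, mul_add, Finset.sum_add_distrib]

/-- The homomorphism `β̂`, with values in the integral matrices. -/
def autMatHom : MulAut F2 →* Matrix (Fin 2) (Fin 2) ℤ where
  toFun γ := autMat γ
  map_one' := by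
    ext i j
    fin_cases i <;> fin_cases j <;> simp [autMat, expSum]
  map_mul' γ δ := by
    ext i j
    exact expSumInt_eq_sum γ i (δ (FreeGroup.of j))

/-- The group `Aut⁺(F₂)`. -/
def AutPlus : Subgroup (MulAut F2) := (Matrix.detMonoidHom.comp autMatHom).ker

theorem mem_autPlus {γ : MulAut F2} : γ ∈ AutPlus ↔ (autMat γ).det = 1 := Iff.rfl

/-- The restriction of `β̂` to `Aut⁺(F₂)`. -/
def autPlusToSL : AutPlus →* SL2Z where
  toFun γ := ⟨autMat γ, γ.2⟩
  map_one' := Subtype.ext (map_one autMatHom)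
  map_mul' γ δ := Subtype.ext (map_mul autMatHom γ.1 δ.1)

theorem autMat_conj (g : F2) : autMat (MulAut.conj g) = 1 := by
  ext i j
  fin_cases i <;> fin_cases j <;> simp [autMat, expSum, MulAut.conj_apply]

theorem closure_xg_yg : Subgroup.closure {xg, yg} = ⊤ := by
  rw [← FreeGroup.closure_range_of]
  congr 1
  ext w
  simp [Fin.exists_fin_two, xg, yg, eq_comm]

theorem MonoidHom.ext_xg_yg {M : Type*} [Monoid M] {f g : F2 →* M} (hx : f xg = g xg)
    (hy : f yg = g yg) : f = g :=
  FreeGroup.ext_hom _ _ fun i => by fin_cases i <;> assumption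

/-- An automorphism of `F₂` acting trivially on the abelianization is inner. -/
theorem exists_eq_conj_of_autMat_eq_one {γ : MulAut F2} (h : autMat γ = 1) :
    ∃ g, γ = MulAut.conj g := by
  have hc : Subgroup.closure {γ xg, γ yg} = ⊤ := by
    have := congrArg (Subgroup.map (γ : F2 ≃* F2).toMonoidHom) closure_xg_yg
    rwa [MonoidHom.map_closure, Set.image_pair,
      Subgroup.map_top_of_surjective _ γ.surjective] at this
  have e : ∀ i j, expSumInt i (γ (FreeGroup.of j)) = (1 : Matrix (Fin 2) (Fin 2) ℤ) i j := by
    intro i j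
    rw [← h]
    rfl
  obtain ⟨g, hx, hy⟩ := exists_conj_eq_of_closure_eq_top hc (e 0 0) (e 1 0) (e 0 1) (e 1 1)
  refine ⟨g⁻¹, MulEquiv.toMonoidHom_injective (MonoidHom.ext_xg_yg ?_ ?_)⟩
  · simpa [MulAut.conj_apply, mul_assoc] using congrArg (g⁻¹ * · * g) hx
  · simpa [MulAut.conj_apply, mul_assoc] using congrArg (g⁻¹ * · * g) hy

/-- The automorphism `x ↦ y`, `y ↦ x⁻¹` of `F₂`. -/
def liftS : MulAut F2 :=
  MonoidHom.toMulEquiv (FreeGroup.lift ![yg, xg⁻¹]) (FreeGroup.lift ![yg⁻¹, xg])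
    (MonoidHom.ext_xg_yg (by simp [xg, yg]) (by simp [xg, yg]))
    (MonoidHom.ext_xg_yg (by simp [xg, yg]) (by simp [xg, yg]))

/-- The automorphism `x ↦ x`, `y ↦ xy` of `F₂`. -/
def liftT : MulAut F2 :=
  MonoidHom.toMulEquiv (FreeGroup.lift ![xg, xg * yg]) (FreeGroup.lift ![xg, xg⁻¹ * yg])
    (MonoidHom.ext_xg_yg (by simp [xg, yg]) (by simp [xg, yg]))
    (MonoidHom.ext_xg_yg (by simp [xg, yg]) (by simp [xg, yg]))

@[simp] theorem liftS_xg : liftS xg = yg := by simp [liftS, xg]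
@[simp] theorem liftS_yg : liftS yg = xg⁻¹ := by simp [liftS, yg]
@[simp] theorem liftT_xg : liftT xg = xg := by simp [liftT, xg]
@[simp] theorem liftT_yg : liftT yg = xg * yg := by simp [liftT, yg]

theorem autMat_liftS : autMat liftS = ModularGroup.S := by
  have h0 (i) : autMat liftS i 0 = expSumInt i (liftS xg) := rfl
  have h1 (i) : autMat liftS i 1 = expSumInt i (liftS yg) := rfl
  ext i j
  fin_cases i <;> fin_cases j <;> simp [h0, h1, ModularGroup.S]

theorem autMat_liftT : autMat liftT = ModularGroup.T := by
  have h0 (i) : autMat liftT i 0 = expSumInt i (liftT xg) := rfl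
  have h1 (i) : autMat liftT i 1 = expSumInt i (liftT yg) := rfl
  ext i j
  fin_cases i <;> fin_cases j <;> simp [h0, h1, ModularGroup.T]

theorem liftS_mem : liftS ∈ AutPlus := by
  rw [mem_autPlus, autMat_liftS]
  exact ModularGroup.S.2

theorem liftT_mem : liftT ∈ AutPlus := by
  rw [mem_autPlus, autMat_liftT]
  exact ModularGroup.T.2

theorem autPlusToSL_surjective : Function.Surjective autPlusToSL := by
  rw [← MonoidHom.range_eq_top, eq_top_iff, ← SpecialLinearGroup.SL2Z_generators,
    Subgroup.closure_le]
  rintro _ (rfl | rfl)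
  · exact ⟨⟨liftS, liftS_mem⟩, Subtype.ext autMat_liftS⟩
  · exact ⟨⟨liftT, liftT_mem⟩, Subtype.ext autMat_liftT⟩

/-- `Aut⁺(F₂)` is generated by `liftS`, `liftT` and the inner automorphisms. -/
theorem autPlus_le {M : Subgroup (MulAut F2)} (hS : liftS ∈ M) (hT : liftT ∈ M)
    (hI : ∀ g, MulAut.conj g ∈ M) : AutPlus ≤ M := by
  intro γ hγ
  have h : autPlusToSL ⟨γ, hγ⟩ ∈ (M.subgroupOf AutPlus).map autPlusToSL := by
    have : (⊤ : Subgroup SL2Z) ≤ (M.subgroupOf AutPlus).map autPlusToSL := by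
      rw [← SpecialLinearGroup.SL2Z_generators, Subgroup.closure_le]
      rintro _ (rfl | rfl)
      · exact ⟨⟨liftS, liftS_mem⟩, hS, Subtype.ext autMat_liftS⟩
      · exact ⟨⟨liftT, liftT_mem⟩, hT, Subtype.ext autMat_liftT⟩
    exact this (Subgroup.mem_top _)
  obtain ⟨δ, hδ, e⟩ := h
  have hk : autPlusToSL (δ⁻¹ * ⟨γ, hγ⟩) = 1 := by rw [map_mul, map_inv, e, inv_mul_cancel]
  obtain ⟨g, hg⟩ := exists_eq_conj_of_autMat_eq_one (congrArg Subtype.val hk)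
  have := M.mul_mem hδ (hI g)
  rw [← hg] at this
  simpa using this

instance : MulAction (MulAut F2) (Set (F2 →* Equiv.Perm (Fin 4))) where
  smul γ C := {ρ | ρ.comp γ.toMonoidHom ∈ C}
  one_smul _ := rfl
  mul_smul _ _ _ := rfl

theorem mem_smul_set_hom {γ : MulAut F2} {C : Set (F2 →* Equiv.Perm (Fin 4))}
    {ρ : F2 →* Equiv.Perm (Fin 4)} : ρ ∈ γ • C ↔ ρ.comp γ.toMonoidHom ∈ C := Iff.rfl

/-- The conjugacy class of a permutation representation of `F₂`. -/
def conjClass (ρ : F2 →* Equiv.Perm (Fin 4)) : Set (F2 →* Equiv.Perm (Fin 4)) :=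
  {τ | ∃ σ : Equiv.Perm (Fin 4), τ = (MulAut.conj σ).toMonoidHom.comp ρ}

theorem mem_conjClass_iff {ρ τ : F2 →* Equiv.Perm (Fin 4)} :
    τ ∈ conjClass ρ ↔ ∃ σ : Equiv.Perm (Fin 4), ∀ w, τ w = σ * ρ w * σ⁻¹ := by
  simp [conjClass, DFunLike.ext_iff]

theorem mem_conjClass_self (ρ : F2 →* Equiv.Perm (Fin 4)) : ρ ∈ conjClass ρ :=
  mem_conjClass_iff.2 ⟨1, by simp⟩

theorem conjClass_eq_of_mem {ρ τ : F2 →* Equiv.Perm (Fin 4)} (h : τ ∈ conjClass ρ) :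
    conjClass τ = conjClass ρ := by
  obtain ⟨σ, h⟩ := mem_conjClass_iff.1 h
  ext π
  simp only [mem_conjClass_iff, h]
  constructor
  · rintro ⟨κ, hκ⟩
    exact ⟨κ * σ, fun w => by simp [hκ, mul_assoc]⟩
  · rintro ⟨κ, hκ⟩
    exact ⟨κ * σ⁻¹, fun w => by simp [hκ, mul_assoc]⟩

theorem inv_smul_conjClass (γ : MulAut F2) (ρ : F2 →* Equiv.Perm (Fin 4)) :
    γ⁻¹ • conjClass ρ = conjClass (ρ.comp γ.toMonoidHom) := by
  ext τ
  simp only [mem_smul_set_hom, mem_conjClass_iff]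
  refine exists_congr fun σ => ⟨fun h w => ?_, fun h w => ?_⟩
  · simpa using h (γ w)
  · simpa using h (γ⁻¹ w)

theorem conj_smul_conjClass (g : F2) (ρ : F2 →* Equiv.Perm (Fin 4)) :
    MulAut.conj g • conjClass ρ = conjClass ρ := by
  rw [eq_comm, ← inv_smul_eq_iff, inv_smul_conjClass]
  exact conjClass_eq_of_mem (mem_conjClass_iff.2 ⟨ρ g, fun w => by simp [MulAut.conj_apply]⟩)

theorem mem_conjClass_of_xg_yg {ρ τ : F2 →* Equiv.Perm (Fin 4)} :
    τ ∈ conjClass ρ ↔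
      ∃ σ : Equiv.Perm (Fin 4), σ * ρ xg * σ⁻¹ = τ xg ∧ σ * ρ yg * σ⁻¹ = τ yg := by
  constructor
  · intro h
    obtain ⟨σ, h⟩ := mem_conjClass_iff.1 h
    exact ⟨σ, (h _).symm, (h _).symm⟩
  · rintro ⟨σ, h1, h2⟩
    exact ⟨σ, MonoidHom.ext_xg_yg h1.symm h2.symm⟩

/-- The monodromy of the horizontal generator of `L(2,3)`. -/
def permX : Equiv.Perm (Fin 4) := Equiv.swap 0 1 * Equiv.swap 1 2

/-- The monodromy of the vertical generator of `L(2,3)`. -/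
def permY : Equiv.Perm (Fin 4) := Equiv.swap 0 3

/-- The monodromies of the origamis in the `SL₂(ℤ)`-orbit of `L(2,3)`. -/
def orbitPair : Fin 9 → Equiv.Perm (Fin 4) × Equiv.Perm (Fin 4) :=
  ![(permX, permY), (permX, permX * permY), (permY, permX⁻¹),
    (permX, permX * (permX * permY)), (permX * permY, permX⁻¹), (permY, permY * permX⁻¹),
    (permX * (permX * permY), permX⁻¹), (permX * permY, permX * permY * permX⁻¹),
    (permX * (permX * permY), permX * (permX * permY) * permX⁻¹)]

/-- The permutation representations of `F₂` attached to `orbitPair`. -/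
def orbitHom (i : Fin 9) : F2 →* Equiv.Perm (Fin 4) :=
  FreeGroup.lift ![(orbitPair i).1, (orbitPair i).2]

@[simp] theorem orbitHom_xg (i : Fin 9) : orbitHom i xg = (orbitPair i).1 := by
  simp [orbitHom, xg]

@[simp] theorem orbitHom_yg (i : Fin 9) : orbitHom i yg = (orbitPair i).2 := by
  simp [orbitHom, yg]

/-- The action of `liftS` on the orbit of `L(2,3)`. -/
def orbitS : Fin 9 → Fin 9 := ![2, 4, 0, 6, 1, 7, 3, 5, 8]

/-- The action of `liftT` on the orbit of `L(2,3)`. -/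
def orbitT : Fin 9 → Fin 9 := ![1, 3, 5, 0, 7, 2, 8, 6, 4]

theorem orbitS_bijective : Function.Bijective orbitS := by decide

theorem orbitT_bijective : Function.Bijective orbitT := by decide

theorem liftS_inv_smul (i : Fin 9) :
    liftS⁻¹ • conjClass (orbitHom i) = conjClass (orbitHom (orbitS i)) := by
  rw [inv_smul_conjClass, eq_comm]
  refine conjClass_eq_of_mem (mem_conjClass_of_xg_yg.2 ?_)
  have : ∀ i, ∃ σ : Equiv.Perm (Fin 4), σ * (orbitPair i).2 * σ⁻¹ = (orbitPair (orbitS i)).1 ∧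
      σ * (orbitPair i).1⁻¹ * σ⁻¹ = (orbitPair (orbitS i)).2 := by
    decide +kernel
  simpa using this i

theorem liftT_inv_smul (i : Fin 9) :
    liftT⁻¹ • conjClass (orbitHom i) = conjClass (orbitHom (orbitT i)) := by
  rw [inv_smul_conjClass, eq_comm]
  refine conjClass_eq_of_mem (mem_conjClass_of_xg_yg.2 ?_)
  have : ∀ i, ∃ σ : Equiv.Perm (Fin 4), σ * (orbitPair i).1 * σ⁻¹ = (orbitPair (orbitT i)).1 ∧
      σ * ((orbitPair i).1 * (orbitPair i).2) * σ⁻¹ = (orbitPair (orbitT i)).2 := by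
    decide +kernel
  simpa using this i

theorem conjClass_orbitHom_injective : Function.Injective fun i => conjClass (orbitHom i) := by
  intro i j h
  have hm : orbitHom i ∈ conjClass (orbitHom j) := by
    have := mem_conjClass_self (orbitHom i)
    rwa [show conjClass (orbitHom i) = conjClass (orbitHom j) from h] at this
  have key : ∀ i j, (∃ σ : Equiv.Perm (Fin 4), σ * (orbitPair j).1 * σ⁻¹ = (orbitPair i).1 ∧
      σ * (orbitPair j).2 * σ⁻¹ = (orbitPair i).2) → i = j := by
    decide +kernel
  exact key i j (by simpa using mem_conjClass_of_xg_yg.1 hm)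

/-- The automorphisms of `F₂` which permute the classes of the representations `orbitHom`. -/
def orbitPreserving : Subgroup (MulAut F2) where
  carrier := {γ | ∃ π : Equiv.Perm (Fin 9),
    ∀ i, γ • conjClass (orbitHom i) = conjClass (orbitHom (π i))}
  one_mem' := ⟨1, fun i => one_smul _ _⟩
  mul_mem' := by
    rintro γ δ ⟨π, hπ⟩ ⟨κ, hκ⟩
    exact ⟨π * κ, fun i => by rw [mul_smul, hκ, hπ, Equiv.Perm.mul_apply]⟩
  inv_mem' := by
    rintro γ ⟨π, hπ⟩
    exact ⟨π⁻¹, fun i => by rw [inv_smul_eq_iff, hπ, ← Equiv.Perm.mul_apply, mul_inv_cancel,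
      Equiv.Perm.one_apply]⟩

theorem autPlus_le_orbitPreserving : AutPlus ≤ orbitPreserving := by
  refine autPlus_le ?_ ?_ fun g => ⟨1, fun i => conj_smul_conjClass g _⟩
  · rw [← inv_mem_iff]
    exact ⟨.ofBijective _ orbitS_bijective, liftS_inv_smul⟩
  · rw [← inv_mem_iff]
    exact ⟨.ofBijective _ orbitT_bijective, liftT_inv_smul⟩

theorem orbit_conjClass :
    MulAction.orbit AutPlus (conjClass (orbitHom 0)) =
      Set.range fun i => conjClass (orbitHom i) := by
  apply subset_antisymm
  · rintro _ ⟨⟨γ, hγ⟩, rfl⟩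
    obtain ⟨π, hπ⟩ := autPlus_le_orbitPreserving hγ
    exact ⟨π 0, (hπ 0).symm⟩
  · have hS (i) (h : conjClass (orbitHom i) ∈ MulAction.orbit AutPlus (conjClass (orbitHom 0))) :
        conjClass (orbitHom (orbitS i)) ∈ MulAction.orbit AutPlus (conjClass (orbitHom 0)) := by
      rw [← liftS_inv_smul]
      exact MulAction.mem_orbit_of_mem_orbit (⟨liftS, liftS_mem⟩⁻¹ : AutPlus) h
    have hT (i) (h : conjClass (orbitHom i) ∈ MulAction.orbit AutPlus (conjClass (orbitHom 0))) :
        conjClass (orbitHom (orbitT i)) ∈ MulAction.orbit AutPlus (conjClass (orbitHom 0)) := by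
      rw [← liftT_inv_smul]
      exact MulAction.mem_orbit_of_mem_orbit (⟨liftT, liftT_mem⟩⁻¹ : AutPlus) h
    have h0 := MulAction.mem_orbit_self (M := AutPlus) (conjClass (orbitHom 0))
    have h1 := hT 0 h0
    have h2 := hS 0 h0
    have h3 := hT _ h1
    have h4 := hS _ h1
    have h5 := hT _ h2
    have h6 := hS _ h3
    have h7 := hT _ h4
    have h8 := hT _ h6
    rintro _ ⟨i, rfl⟩
    fin_cases i
    exacts [h0, h1, h2, h3, h4, h5, h6, h7, h8]

theorem index_stabilizer_conjClass :
    (MulAction.stabilizer AutPlus (conjClass (orbitHom 0))).index = 9 := by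
  rw [MulAction.index_stabilizer, orbit_conjClass, ← Set.image_univ,
    Set.ncard_image_of_injective _ conjClass_orbitHom_injective, Set.ncard_univ,
    Nat.card_eq_fintype_card, Fintype.card_fin]

theorem ker_autPlusToSL_le :
    autPlusToSL.ker ≤ MulAction.stabilizer AutPlus (conjClass (orbitHom 0)) := by
  rintro ⟨γ, hγ⟩ h
  obtain ⟨g, rfl⟩ := exists_eq_conj_of_autMat_eq_one (congrArg Subtype.val h)
  exact conj_smul_conjClass g _

/-- Coset representatives of `U_L` in `F₂`. -/
def cosetRep : Fin 4 → F2 := ![1, xg, xg ^ 2, yg]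

theorem orbitHom_zero_cosetRep (i : Fin 4) : orbitHom 0 (cosetRep i) 0 = i := by
  have : ∀ i, (![1, permX, permX ^ 2, permY] : Fin 4 → Equiv.Perm (Fin 4)) i 0 = i := by decide
  refine Eq.trans ?_ (this i)
  fin_cases i <;> simp [cosetRep, orbitPair]

theorem orbitHom_zero_of_mem_UL {w : F2} (h : w ∈ UL) : orbitHom 0 w 0 = 0 := by
  let H : Subgroup F2 := (MulAction.stabilizer (Equiv.Perm (Fin 4)) (0 : Fin 4)).comap (orbitHom 0)
  suffices UL ≤ H from this h
  rw [UL, Subgroup.closure_le]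
  rintro _ (rfl | rfl | rfl | rfl | rfl) <;>
    simp only [H, SetLike.mem_coe, Subgroup.mem_comap, MulAction.mem_stabilizer_iff, map_mul,
      map_inv, map_pow, orbitHom_xg, orbitHom_yg] <;> decide

theorem cosetRep_inv_mul_mem_UL (w : F2) (i : Fin 4) :
    (cosetRep (orbitHom 0 w i))⁻¹ * w * cosetRep i ∈ UL := by
  have h1 : xg ^ 3 ∈ UL := Subgroup.subset_closure (by simp)
  have h2 : xg * yg * xg⁻¹ ∈ UL := Subgroup.subset_closure (by simp)
  have h3 : xg ^ 2 * yg * (xg ^ 2)⁻¹ ∈ UL := Subgroup.subset_closure (by simp)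
  have h4 : yg * xg * yg⁻¹ ∈ UL := Subgroup.subset_closure (by simp)
  have h5 : yg ^ 2 ∈ UL := Subgroup.subset_closure (by simp)
  have hx : ∀ i, (cosetRep (permX i))⁻¹ * xg * cosetRep i ∈ UL := by
    rw [Fin.forall_fin_succ, Fin.forall_fin_succ, Fin.forall_fin_two]
    refine ⟨?_, ?_, ?_, ?_⟩
    · change xg⁻¹ * xg * 1 ∈ UL
      simp
    · change (xg ^ 2)⁻¹ * xg * xg ∈ UL
      simp [pow_succ, mul_assoc]
    · change 1⁻¹ * xg * xg ^ 2 ∈ UL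
      simpa [pow_succ, mul_assoc] using h1
    · change yg⁻¹ * xg * yg ∈ UL
      simpa [pow_succ, mul_assoc] using mul_mem (mul_mem (inv_mem h5) h4) h5
  have hy : ∀ i, (cosetRep (permY i))⁻¹ * yg * cosetRep i ∈ UL := by
    rw [Fin.forall_fin_succ, Fin.forall_fin_succ, Fin.forall_fin_two]
    refine ⟨?_, ?_, ?_, ?_⟩
    · change yg⁻¹ * yg * 1 ∈ UL
      simp
    · change xg⁻¹ * yg * xg ∈ UL
      simpa [pow_succ, mul_assoc] using mul_mem (mul_mem (inv_mem h1) h3) h1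
    · change (xg ^ 2)⁻¹ * yg * xg ^ 2 ∈ UL
      simpa [pow_succ, mul_assoc] using mul_mem (mul_mem (inv_mem h1) h2) h1
    · change 1⁻¹ * yg * yg ∈ UL
      simpa [pow_succ, mul_assoc] using h5
  have hof : ∀ j i, (cosetRep (orbitHom 0 (FreeGroup.of j) i))⁻¹ * FreeGroup.of j * cosetRep i
      ∈ UL := by
    intro j i
    fin_cases j
    exacts [hx i, hy i]
  induction w using FreeGroup.induction_on generalizing i with
  | C1 => simp
  | of j => exact hof j i
  | inv_of j _ =>
    have := inv_mem (hof j ((orbitHom 0 (FreeGroup.of j))⁻¹ i))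
    simpa [mul_assoc] using this
  | mul u v hu hv => simpa [mul_assoc] using mul_mem (hu (orbitHom 0 v i)) (hv i)

theorem mem_UL_iff {w : F2} : w ∈ UL ↔ orbitHom 0 w 0 = 0 := by
  refine ⟨orbitHom_zero_of_mem_UL, fun h => ?_⟩
  have := cosetRep_inv_mul_mem_UL w 0
  rw [h] at this
  simpa [cosetRep] using this

theorem map_UL_eq_iff {γ : MulAut F2} :
    Subgroup.map (γ : F2 ≃* F2).toMonoidHom UL = UL ↔ ∀ w, γ w ∈ UL ↔ w ∈ UL := by
  constructor
  · intro h w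
    nth_rewrite 1 [← h]
    exact Subgroup.mem_map_iff_mem γ.injective
  · intro h
    ext w
    obtain ⟨v, rfl⟩ := γ.surjective w
    exact (Subgroup.mem_map_iff_mem γ.injective).trans (h v).symm

theorem smul_conjClass_eq_of_map_UL_eq {γ : MulAut F2}
    (h : ∀ w, γ w ∈ UL ↔ w ∈ UL) : γ • conjClass (orbitHom 0) = conjClass (orbitHom 0) := by
  let s : Fin 4 → Fin 4 := fun i => orbitHom 0 (γ (cosetRep i)) 0
  have hs : Function.Injective s := by
    intro i j hij
    have : γ ((cosetRep j)⁻¹ * cosetRep i) ∈ UL := by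
      rw [mem_UL_iff, map_mul, map_inv, map_mul, map_inv, Equiv.Perm.mul_apply,
        Equiv.Perm.inv_eq_iff_eq]
      exact hij
    rw [h, mem_UL_iff, map_mul, map_inv, Equiv.Perm.mul_apply, Equiv.Perm.inv_eq_iff_eq,
      orbitHom_zero_cosetRep, orbitHom_zero_cosetRep] at this
    exact this
  have hw (w i) : orbitHom 0 (γ w) (s i) = s (orbitHom 0 w i) := by
    have := (h _).2 (cosetRep_inv_mul_mem_UL w i)
    simp only [mem_UL_iff, map_mul, map_inv, mul_assoc, Equiv.Perm.mul_apply,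
      Equiv.Perm.inv_eq_iff_eq] at this
    exact this
  rw [eq_comm, ← inv_smul_eq_iff, inv_smul_conjClass]
  refine conjClass_eq_of_mem (mem_conjClass_iff.2
    ⟨.ofBijective s (Finite.injective_iff_bijective.1 hs), fun w => ?_⟩)
  rw [eq_mul_inv_iff_mul_eq]
  exact Equiv.ext (hw w)

theorem exists_conj_mul_map_UL_eq {γ : MulAut F2}
    (h : γ • conjClass (orbitHom 0) = conjClass (orbitHom 0)) :
    ∃ g, ∀ w, (MulAut.conj g * γ : MulAut F2) w ∈ UL ↔ w ∈ UL := by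
  have hm := mem_conjClass_self ((orbitHom 0).comp γ.toMonoidHom)
  rw [← inv_smul_conjClass, inv_smul_eq_iff.2 h.symm] at hm
  obtain ⟨σ, hσ⟩ := mem_conjClass_iff.1 hm
  have hσ' : ∀ w, orbitHom 0 (γ w) = σ * orbitHom 0 w * σ⁻¹ := hσ
  refine ⟨(cosetRep (σ 0))⁻¹, fun w => ?_⟩
  rw [mem_UL_iff, mem_UL_iff, MulAut.mul_apply, MulAut.conj_apply, inv_inv, map_mul, map_mul,
    map_inv, Equiv.Perm.mul_apply, Equiv.Perm.mul_apply, Equiv.Perm.inv_eq_iff_eq, hσ',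
    orbitHom_zero_cosetRep]
  simp

/-- The Veech group `Γ(U_L)` of the origami `L(2,3)` is a subgroup of index `9` in
`SL₂(ℤ)`. -/
theorem veech_UL_index_nine :
    ∃ Γ : Subgroup SL2Z, (Γ : Set SL2Z) = VeechGroup UL ∧ Γ.index = 9 := by
  refine ⟨(MulAction.stabilizer AutPlus (conjClass (orbitHom 0))).map autPlusToSL, ?_, ?_⟩
  · ext A
    constructor
    · rintro ⟨⟨γ, hγ⟩, h, rfl⟩
      obtain ⟨g, hg⟩ := exists_conj_mul_map_UL_eq h
      have e : autMat (MulAut.conj g * γ) = autMat γ := by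
        have := map_mul autMatHom (MulAut.conj g) γ
        rwa [show autMatHom (MulAut.conj g) = 1 from autMat_conj g, one_mul] at this
      exact ⟨MulAut.conj g * γ, ⟨e ▸ hγ, map_UL_eq_iff.2 hg⟩, e.symm⟩
    · rintro ⟨γ, ⟨hd, h⟩, e⟩
      exact ⟨⟨γ, hd⟩, smul_conjClass_eq_of_map_UL_eq (map_UL_eq_iff.1 h), Subtype.ext e.symm⟩
  · rw [Subgroup.index_map_eq _ autPlusToSL_surjective ker_autPlusToSL_le,
      index_stabilizer_conjClass]
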